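/- Let q ≥ 2 be an integer and N, M positive integers. In the attenuated space poset A_q(N,M) (subspaces x of an (N+M)-dimensional F_q-space H with x ∩ h = 0 for a fixed M-dimensional subspace h), the matrices L, R (lowering and raising), the projections F_i onto rank-i elements, K = Σ_i q^{N+M−i}F_i, and the matrix S (with (x,y)-entry 1 iff dim x = dim y = i and x + y is an (i+1)-dimensional subspace meeting h in dimension one) satisfy: S + LR − RL = (K − q^{N+M}K⁻¹ + (1 − q^M)I)/(q − 1). -/

import Mathlib

open scoped Classical

/-- The attenuated space poset: subspaces of `H` intersecting `h` trivially. -/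
abbrev AttP (F : Type) [Field F] (H : Type) [AddCommGroup H] [Module F H]
    (h : Submodule F H) : Type := {x : Submodule F H // x ⊓ h = ⊥}

instance attPFinite (F : Type) [Field F] (H : Type) [AddCommGroup H] [Module F H]
    [Finite H] (h : Submodule F H) : Finite (AttP F H h) := by
  have : Finite (Submodule F H) :=
    Finite.of_injective (fun s => (s : Set H)) SetLike.coe_injective
  exact Subtype.finite

noncomputable instance attPFintype (F : Type) [Field F] (H : Type) [AddCommGroup H]
    [Module F H] [Finite H] (h : Submodule F H) : Fintype (AttP F H h) :=
  Fintype.ofFinite _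

open Module

section Counting

variable {F : Type*} [Field F] {V : Type*} [AddCommGroup V] [Module F V]

lemma finrank_sup_span_singleton [FiniteDimensional F V] {x : Submodule F V} {v : V}
    (hv : v ∉ x) : finrank F ↥(x ⊔ F ∙ v) = finrank F x + 1 := by
  have hv0 : v ≠ 0 := fun h0 => hv (h0 ▸ x.zero_mem)
  have hd : x ⊓ F ∙ v = ⊥ :=
    disjoint_iff.mp ((Submodule.disjoint_span_singleton' hv0).mpr hv)
  have key := Submodule.finrank_sup_add_finrank_inf_eq x (F ∙ v)
  rwa [hd, finrank_bot, finrank_span_singleton hv0, add_zero] at key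

lemma sup_span_singleton_eq_iff [FiniteDimensional F V] {x z : Submodule F V} {v : V}
    (hv : v ∉ x) (hxz : x ≤ z) (hz : finrank F z = finrank F x + 1) :
    x ⊔ F ∙ v = z ↔ v ∈ z := by
  constructor
  · rintro rfl
    exact Submodule.mem_sup_right (Submodule.mem_span_singleton_self v)
  · intro hvz
    apply Submodule.eq_of_le_of_finrank_eq
    · exact sup_le hxz ((Submodule.span_singleton_le_iff_mem v z).mpr hvz)
    · rw [finrank_sup_span_singleton hv, hz]

lemma card_filter_mem_diff [Fintype F] [Fintype V] {x z : Submodule F V} (hxz : x ≤ z) :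
    (Finset.univ.filter fun v : V => v ∈ z ∧ v ∉ x).card + Fintype.card F ^ finrank F x
      = Fintype.card F ^ finrank F z := by
  rw [← Module.card_eq_pow_finrank (V := x), ← Module.card_eq_pow_finrank (V := z),
    Fintype.card_subtype, Fintype.card_subtype, ← Finset.card_union_of_disjoint]
  · congr 1
    ext v
    have := @hxz v
    simp only [Finset.mem_union, Finset.mem_filter, Finset.mem_univ, true_and]
    tauto
  · rw [Finset.disjoint_left]
    intro v
    simp only [Finset.mem_filter, Finset.mem_univ, true_and]
    tauto

lemma finrank_ker_add_one [FiniteDimensional F V] {f : Dual F V} (hf : f ≠ 0) :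
    finrank F (LinearMap.ker f) + 1 = finrank F V := by
  have key := LinearMap.finrank_range_add_finrank_ker f
  rw [LinearMap.range_eq_top.mpr (LinearMap.surjective hf), finrank_top, finrank_self] at key
  omega

/-- Hyperplanes of `V`, each counted with its `q - 1` nonzero defining functionals. -/
lemma card_hyperplanes [Fintype F] [Finite V] [Fintype (Submodule F V)] :
    (Finset.univ.filter fun z : Submodule F V => finrank F z + 1 = finrank F V).card
      * (Fintype.card F - 1) + 1 = Fintype.card F ^ finrank F V := by
  have : Finite (Dual F V) := Module.finite_of_finite F
  have : Fintype (Dual F V) := Fintype.ofFinite _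
  have hmaps : Set.MapsTo (fun f : Dual F V => LinearMap.ker f)
      (Finset.univ.filter fun f : Dual F V => f ∈ (⊤ : Submodule F (Dual F V)) ∧
        f ∉ (⊥ : Submodule F (Dual F V)))
      (Finset.univ.filter fun z : Submodule F V => finrank F z + 1 = finrank F V) := by
    intro f hf
    simp only [Finset.coe_filter, Finset.mem_univ, true_and, Set.mem_ofPred_eq,
      Submodule.mem_top, Submodule.mem_bot] at hf ⊢
    exact finrank_ker_add_one hf
  have hcard := Finset.card_eq_sum_card_fiberwise hmaps
  have htot := card_filter_mem_diff (bot_le : (⊥ : Submodule F (Dual F V)) ≤ ⊤)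
  rw [Finset.sum_const_nat (m := Fintype.card F - 1)] at hcard
  · rw [hcard, finrank_bot, finrank_top, pow_zero, Subspace.dual_finrank_eq] at htot
    exact htot
  · intro z hz
    simp only [Finset.mem_filter, Finset.mem_univ, true_and] at hz
    have hann := Subspace.finrank_add_finrank_dualAnnihilator_eq z
    have hone := card_filter_mem_diff (bot_le : ⊥ ≤ z.dualAnnihilator)
    rw [finrank_bot, pow_zero, show finrank F z.dualAnnihilator = 1 by omega, pow_one] at hone
    rw [← hone, Nat.add_sub_cancel, Finset.filter_filter]
    congr 1
    ext f
    simp only [Finset.mem_filter, Finset.mem_univ, true_and, Submodule.mem_top,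
      Submodule.mem_bot, Submodule.mem_dualAnnihilator]
    constructor
    · rintro ⟨hf, rfl⟩
      exact ⟨fun w hw => hw, hf⟩
    · rintro ⟨hw, hf⟩
      refine ⟨hf, (Submodule.eq_of_le_of_finrank_eq (fun w hwz => hw w hwz) ?_).symm⟩
      have := finrank_ker_add_one hf
      omega

end Counting

section Attenuated

variable {F : Type} [Field F] {H : Type} [AddCommGroup H] [Module F H] {h : Submodule F H}

lemma AttP.inf_eq_bot_of_le (x : AttP F H h) {y : Submodule F H} (hy : y ≤ x.1) :
    y ⊓ h = ⊥ :=
  le_bot_iff.mp ((inf_le_inf_right h hy).trans x.2.le)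

lemma AttP.covers_iff [FiniteDimensional F H] (x y : AttP F H h) :
    (x.1 < y.1 ∧ ¬∃ z : AttP F H h, x.1 < z.1 ∧ z.1 < y.1) ↔
      x.1 ≤ y.1 ∧ finrank F y.1 = finrank F x.1 + 1 := by
  constructor
  · rintro ⟨hlt, hno⟩
    refine ⟨hlt.le, ?_⟩
    obtain ⟨v, hvy, hvx⟩ := SetLike.exists_of_lt hlt
    have hle : x.1 ⊔ F ∙ v ≤ y.1 :=
      sup_le hlt.le ((Submodule.span_singleton_le_iff_mem v _).mpr hvy)
    have hxz : x.1 < x.1 ⊔ F ∙ v := left_lt_sup.mpr fun hs =>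
      hvx ((Submodule.span_singleton_le_iff_mem v _).mp hs)
    rcases hle.eq_or_lt with heq | hlt'
    · rw [← heq, finrank_sup_span_singleton hvx]
    · exact absurd ⟨⟨_, y.inf_eq_bot_of_le hle⟩, hxz, hlt'⟩ hno
  · rintro ⟨hle, hfin⟩
    refine ⟨lt_of_le_of_ne hle fun heq => by rw [heq] at hfin; omega, ?_⟩
    rintro ⟨z, hxz, hzy⟩
    have h1 := Submodule.finrank_lt_finrank_of_lt hxz
    have h2 := Submodule.finrank_lt_finrank_of_lt hzy
    omega

lemma AttP.inf_sup_eq_of_le {x z : AttP F H h} (hxz : x.1 ≤ z.1) : z.1 ⊓ (x.1 ⊔ h) = x.1 := by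
  rw [inf_comm, sup_inf_assoc_of_le h hxz, inf_comm, z.2, sup_bot_eq]

lemma AttP.finrank_sup [FiniteDimensional F H] (x : AttP F H h) :
    finrank F ↥(x.1 ⊔ h) = finrank F x.1 + finrank F h := by
  have key := Submodule.finrank_sup_add_finrank_inf_eq x.1 h
  rwa [x.2, finrank_bot, add_zero] at key

lemma AttP.card_upper_covers [Fintype F] [Finite H] (x : AttP F H h) :
    (Finset.univ.filter fun z : AttP F H h =>
        x.1 ≤ z.1 ∧ finrank F z.1 = finrank F x.1 + 1).card
      * (Fintype.card F ^ (finrank F x.1 + 1) - Fintype.card F ^ finrank F x.1)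
      + Fintype.card F ^ (finrank F x.1 + finrank F h) = Fintype.card F ^ finrank F H := by
  have : Fintype H := Fintype.ofFinite H
  have hmem : ∀ v : H, v ∉ x.1 ⊔ h → (x.1 ⊔ F ∙ v) ⊓ h = ⊥ := by
    intro v hv
    rw [eq_bot_iff]
    rintro w ⟨hw, hwh⟩
    obtain ⟨a, ha, b, hb, rfl⟩ := Submodule.mem_sup.mp hw
    obtain ⟨c, rfl⟩ := Submodule.mem_span_singleton.mp hb
    have hcv : c • v ∈ x.1 ⊔ h := by
      have := sub_mem (Submodule.mem_sup_right hwh : a + c • v ∈ x.1 ⊔ h)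
        (Submodule.mem_sup_left ha)
      rwa [add_sub_cancel_left] at this
    rcases eq_or_ne c 0 with rfl | hc
    · rw [← x.2]
      rw [zero_smul, add_zero] at hwh ⊢
      exact ⟨ha, hwh⟩
    · exact absurd ((Submodule.smul_mem_iff _ hc).mp hcv) hv
  let f : H → AttP F H h := fun v =>
    if hv : (x.1 ⊔ F ∙ v) ⊓ h = ⊥ then ⟨x.1 ⊔ F ∙ v, hv⟩ else x
  have hf : ∀ v, v ∉ x.1 ⊔ h → (f v).1 = x.1 ⊔ F ∙ v := by
    intro v hv
    simp only [f, dif_pos (hmem v hv)]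
  have hx : ∀ v, v ∉ x.1 ⊔ h → v ∉ x.1 := fun v hv hvx => hv (Submodule.mem_sup_left hvx)
  have hmaps : Set.MapsTo f
      (Finset.univ.filter fun v : H => v ∈ (⊤ : Submodule F H) ∧ v ∉ x.1 ⊔ h)
      (Finset.univ.filter fun z : AttP F H h =>
        x.1 ≤ z.1 ∧ finrank F z.1 = finrank F x.1 + 1) := by
    intro v hv
    simp only [Finset.coe_filter, Finset.mem_univ, true_and, Set.mem_ofPred_eq,
      Submodule.mem_top] at hv ⊢
    rw [hf v hv]
    exact ⟨le_sup_left, finrank_sup_span_singleton (hx v hv)⟩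
  have hcard := Finset.card_eq_sum_card_fiberwise hmaps
  have htot := card_filter_mem_diff (le_top : x.1 ⊔ h ≤ ⊤)
  rw [Finset.sum_const_nat
    (m := Fintype.card F ^ (finrank F x.1 + 1) - Fintype.card F ^ finrank F x.1)] at hcard
  · rw [hcard, finrank_top, x.finrank_sup] at htot
    exact htot
  · intro z hz
    simp only [Finset.mem_filter, Finset.mem_univ, true_and] at hz
    have hdiff := card_filter_mem_diff hz.1
    rw [hz.2] at hdiff
    rw [← hdiff, Nat.add_sub_cancel, Finset.filter_filter]
    congr 1
    ext v
    simp only [Finset.mem_filter, Finset.mem_univ, true_and, Submodule.mem_top]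
    constructor
    · rintro ⟨hv, rfl⟩
      refine ⟨?_, hx v hv⟩
      rw [hf v hv]
      exact Submodule.mem_sup_right (Submodule.mem_span_singleton_self v)
    · rintro ⟨hvz, hvx⟩
      have hv : v ∉ x.1 ⊔ h := fun hv =>
        hvx ((AttP.inf_sup_eq_of_le hz.1).le ⟨hvz, hv⟩)
      refine ⟨hv, Subtype.ext ?_⟩
      rw [hf v hv]
      exact (sup_span_singleton_eq_iff hvx hz.1 hz.2).mpr hvz

lemma AttP.card_lower_covers [Fintype F] [Finite H] (x : AttP F H h) :
    (Finset.univ.filter fun z : AttP F H h =>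
        z.1 ≤ x.1 ∧ finrank F x.1 = finrank F z.1 + 1).card
      * (Fintype.card F - 1) + 1 = Fintype.card F ^ finrank F x.1 := by
  have : Finite (Submodule F x.1) :=
    Finite.of_injective (fun s => (s : Set x.1)) SetLike.coe_injective
  have : Fintype (Submodule F x.1) := Fintype.ofFinite _
  rw [← card_hyperplanes (F := F) (V := x.1)]
  congr 2
  have hmap : ∀ z : Submodule F x.1, finrank F (z.map x.1.subtype) = finrank F z := fun z =>
    (Submodule.equivMapOfInjective _ x.1.injective_subtype z).finrank_eq.symm
  symm
  refine Finset.card_bij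
    (fun z _ => ⟨z.map x.1.subtype, x.inf_eq_bot_of_le (Submodule.map_subtype_le _ _)⟩)
    ?_ ?_ ?_
  · intro z hz
    simp only [Finset.mem_filter, Finset.mem_univ, true_and] at hz ⊢
    exact ⟨Submodule.map_subtype_le _ _, by rw [hmap, hz]⟩
  · intro z _ w _ hzw
    exact Submodule.map_injective_of_injective x.1.injective_subtype (congrArg Subtype.val hzw)
  · intro z hz
    simp only [Finset.mem_filter, Finset.mem_univ, true_and] at hz
    have heq : (z.1.comap x.1.subtype).map x.1.subtype = z.1 := by
      rw [Submodule.map_comap_subtype, inf_eq_right.mpr hz.1]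
    refine ⟨z.1.comap x.1.subtype, ?_, Subtype.ext heq⟩
    simp only [Finset.mem_filter, Finset.mem_univ, true_and]
    rw [← hmap, heq, hz.2]

lemma AttP.finrank_le [FiniteDimensional F H] (x : AttP F H h) :
    finrank F x.1 + finrank F h ≤ finrank F H := by
  rw [← x.finrank_sup]
  exact Submodule.finrank_le _

lemma AttP.finrank_inf_le_one {x : AttP F H h} [FiniteDimensional F H] {w : Submodule F H}
    (hxw : x.1 ≤ w) (hw : finrank F w = finrank F x.1 + 1) : finrank F ↥(w ⊓ h) ≤ 1 := by
  have key := Submodule.finrank_sup_add_finrank_inf_eq x.1 (w ⊓ h)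
  have hbot : x.1 ⊓ (w ⊓ h) = ⊥ := by
    rw [inf_left_comm, x.2, inf_bot_eq]
  have hle := Submodule.finrank_mono (sup_le hxw (inf_le_left : w ⊓ h ≤ w))
  rw [hbot, finrank_bot] at key
  omega

lemma eq_sup_of_finrank [FiniteDimensional F H] {x y z : Submodule F H} (hxy : x ≠ y)
    (hxz : x ≤ z) (hyz : y ≤ z) (hx : finrank F z = finrank F x + 1)
    (hy : finrank F z = finrank F y + 1) : z = x ⊔ y := by
  have hlt : x < x ⊔ y := left_lt_sup.mpr fun hyx =>
    hxy (Submodule.eq_of_le_of_finrank_eq hyx (by omega)).symm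
  have h1 := Submodule.finrank_lt_finrank_of_lt hlt
  have hle := sup_le hxz hyz
  exact (Submodule.eq_of_le_of_finrank_le hle (by omega)).symm

lemma eq_inf_of_finrank [FiniteDimensional F H] {x y z : Submodule F H} (hxy : x ≠ y)
    (hzx : z ≤ x) (hzy : z ≤ y) (hx : finrank F x = finrank F z + 1)
    (hy : finrank F y = finrank F z + 1) : z = x ⊓ y := by
  have hlt : x ⊓ y < x := inf_lt_left.mpr fun hle =>
    hxy (Submodule.eq_of_le_of_finrank_eq hle (by omega))
  have h1 := Submodule.finrank_lt_finrank_of_lt hlt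
  exact Submodule.eq_of_le_of_finrank_le (le_inf hzx hzy) (by omega)

/-- The common upper covers of `x ≠ y`: at most `x ⊔ y`, provided it lies in the poset. -/
lemma AttP.card_common_upper_covers [Finite H] {x y : AttP F H h} (hxy : x ≠ y) :
    (Finset.univ.filter fun z : AttP F H h =>
        (x.1 ≤ z.1 ∧ finrank F z.1 = finrank F x.1 + 1) ∧
          (y.1 ≤ z.1 ∧ finrank F z.1 = finrank F y.1 + 1)).card
      = if finrank F x.1 = finrank F y.1 ∧ finrank F ↥(x.1 ⊔ y.1) = finrank F x.1 + 1 ∧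
          finrank F ↥((x.1 ⊔ y.1) ⊓ h) = 0 then 1 else 0 := by
  have hne : x.1 ≠ y.1 := fun he => hxy (Subtype.ext he)
  split_ifs with hc
  · obtain ⟨h1, h2, h3⟩ := hc
    rw [Finset.card_eq_one]
    refine ⟨⟨x.1 ⊔ y.1, Submodule.finrank_eq_zero.mp h3⟩, ?_⟩
    ext z
    simp only [Finset.mem_filter, Finset.mem_univ, true_and, Finset.mem_singleton]
    constructor
    · rintro ⟨⟨a, b⟩, c, d⟩
      exact Subtype.ext (eq_sup_of_finrank hne a c b d)
    · rintro rfl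
      exact ⟨⟨le_sup_left, h2⟩, le_sup_right, by rw [h2, h1]⟩
  · rw [Finset.card_eq_zero, Finset.filter_eq_empty_iff]
    rintro z - ⟨⟨a, b⟩, c, d⟩
    have hz := eq_sup_of_finrank hne a c b d
    refine hc ⟨by omega, by rw [← hz, b], ?_⟩
    rw [← hz, z.2, finrank_bot]

/-- The common lower covers of `x ≠ y`: at most `x ⊓ y`. -/
lemma AttP.card_common_lower_covers [Finite H] {x y : AttP F H h} (hxy : x ≠ y) :
    (Finset.univ.filter fun z : AttP F H h =>
        (z.1 ≤ x.1 ∧ finrank F x.1 = finrank F z.1 + 1) ∧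
          (z.1 ≤ y.1 ∧ finrank F y.1 = finrank F z.1 + 1)).card
      = if finrank F x.1 = finrank F y.1 ∧ finrank F ↥(x.1 ⊔ y.1) = finrank F x.1 + 1
          then 1 else 0 := by
  have hne : x.1 ≠ y.1 := fun he => hxy (Subtype.ext he)
  have key := Submodule.finrank_sup_add_finrank_inf_eq x.1 y.1
  split_ifs with hc
  · rw [Finset.card_eq_one]
    refine ⟨⟨x.1 ⊓ y.1, x.inf_eq_bot_of_le inf_le_left⟩, ?_⟩
    ext z
    simp only [Finset.mem_filter, Finset.mem_univ, true_and, Finset.mem_singleton]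
    constructor
    · rintro ⟨⟨a, b⟩, c, d⟩
      exact Subtype.ext (eq_inf_of_finrank hne a c b d)
    · rintro rfl
      exact ⟨⟨inf_le_left, by dsimp only; omega⟩, inf_le_right, by dsimp only; omega⟩
  · rw [Finset.card_eq_zero, Finset.filter_eq_empty_iff]
    rintro z - ⟨⟨a, b⟩, c, d⟩
    have hz := eq_inf_of_finrank hne a c b d
    rw [← hz] at key
    exact hc ⟨by omega, by omega⟩

end Attenuated

theorem stmt_16 (q N M : ℕ) (hq : 2 ≤ q) (hN : 0 < N) (hM : 0 < M)
    (F : Type) [Field F] [Fintype F] (hF : Fintype.card F = q)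
    (H : Type) [AddCommGroup H] [Module F H] [Finite H]
    (hH : Module.finrank F H = N + M)
    (h : Submodule F H) (hh : Module.finrank F ↥h = M)
    (L R S K Kinv : Matrix (AttP F H h) (AttP F H h) ℂ)
    (Fm : ℕ → Matrix (AttP F H h) (AttP F H h) ℂ)
    (hL : ∀ x y : AttP F H h, L x y =
      if x.1 < y.1 ∧ ¬∃ z : AttP F H h, x.1 < z.1 ∧ z.1 < y.1 then 1 else 0)
    (hR : ∀ x y : AttP F H h, R x y =
      if y.1 < x.1 ∧ ¬∃ z : AttP F H h, y.1 < z.1 ∧ z.1 < x.1 then 1 else 0)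
    (hS : ∀ x y : AttP F H h, S x y =
      if Module.finrank F ↥x.1 = Module.finrank F ↥y.1
        ∧ Module.finrank F ↥(x.1 ⊔ y.1) = Module.finrank F ↥x.1 + 1
        ∧ Module.finrank F ↥((x.1 ⊔ y.1) ⊓ h) = 1 then 1 else 0)
    (hFm : ∀ (i : ℕ) (x y : AttP F H h), Fm i x y =
      if x = y ∧ Module.finrank F ↥x.1 = i then 1 else 0)
    (hK : K = ∑ i ∈ Finset.range (N + 1), ((q : ℂ) ^ (N + M - i)) • Fm i)
    (hKinv : Kinv = ∑ i ∈ Finset.range (N + 1), ((q : ℂ) ^ ((i : ℤ) - N - M)) • Fm i) :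
    S + L * R - R * L
      = ((q : ℂ) - 1)⁻¹ • (K - ((q : ℂ) ^ (N + M)) • Kinv + ((1 : ℂ) - (q : ℂ) ^ M) • 1) := by
  subst hF hh
  simp only [AttP.covers_iff] at hL hR
  have hLR : ∀ x y, (L * R) x y = ((Finset.univ.filter fun z : AttP F H h =>
      (x.1 ≤ z.1 ∧ finrank F z.1 = finrank F x.1 + 1) ∧
        (y.1 ≤ z.1 ∧ finrank F z.1 = finrank F y.1 + 1)).card : ℂ) := by
    intro x y
    simp only [Matrix.mul_apply, hL, hR, ite_zero_mul_ite_zero, mul_one, Finset.sum_boole]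
  have hRL : ∀ x y, (R * L) x y = ((Finset.univ.filter fun z : AttP F H h =>
      (z.1 ≤ x.1 ∧ finrank F x.1 = finrank F z.1 + 1) ∧
        (z.1 ≤ y.1 ∧ finrank F y.1 = finrank F z.1 + 1)).card : ℂ) := by
    intro x y
    simp only [Matrix.mul_apply, hL, hR, ite_zero_mul_ite_zero, mul_one, Finset.sum_boole]
  ext x y
  simp only [Matrix.add_apply, Matrix.sub_apply, Matrix.smul_apply, smul_eq_mul, hLR, hRL, hS,
    hK, hKinv, Matrix.sum_apply, hFm]
  rcases eq_or_ne x y with rfl | hxy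
  · have hi : finrank F x.1 < N + 1 := by
      have := x.finrank_le
      omega
    have hup := x.card_upper_covers
    have hlow := x.card_lower_covers
    have hpow : Fintype.card F ^ finrank F x.1 ≤ Fintype.card F ^ (finrank F x.1 + 1) :=
      Nat.pow_le_pow_right (by omega) (by omega)
    rw [hH] at hup
    apply_fun (Nat.cast : ℕ → ℂ) at hup hlow
    push_cast [Nat.cast_sub hpow, Nat.cast_sub (show 1 ≤ Fintype.card F by omega)] at hup hlow
    have hq0 : (Fintype.card F : ℂ) ≠ 0 := by
      exact_mod_cast (show Fintype.card F ≠ 0 by omega)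
    have hq1 : (Fintype.card F : ℂ) - 1 ≠ 0 := by
      rw [sub_ne_zero]
      exact_mod_cast (show Fintype.card F ≠ 1 by omega)
    have hSx : ¬(finrank F ↥(x.1 ⊔ x.1) = finrank F x.1 + 1 ∧
        finrank F ↥((x.1 ⊔ x.1) ⊓ h) = 1) := by
      rw [sup_idem]
      omega
    simp only [and_self, true_and, if_neg hSx, zero_add, Matrix.one_apply_eq, mul_one, mul_ite,
      mul_zero, Finset.sum_ite_eq, Finset.mem_range, if_pos hi]
    generalize (Finset.card _ : ℂ) = a at hup ⊢
    generalize (Finset.card _ : ℂ) = b at hlow ⊢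
    generalize finrank F x.1 = i at *
    generalize finrank F h = m at *
    obtain ⟨j, rfl⟩ : ∃ j, N = i + j := ⟨N - i, by omega⟩
    rw [show i + j + m - i = j + m by omega,
      show ((i : ℤ) - ((i + j : ℕ) : ℤ) - m) = -((j + m : ℕ) : ℤ) by push_cast; ring,
      zpow_neg, zpow_natCast]
    generalize (Fintype.card F : ℂ) = Q at *
    have hQi : Q ^ i ≠ 0 := pow_ne_zero _ hq0
    have hup' : a * (Q - 1) = Q ^ (j + m) - Q ^ m := by
      apply mul_left_cancel₀ hQi
      linear_combination hup
    have hinv : Q ^ (i + j + m) * (Q ^ (j + m))⁻¹ = Q ^ i := by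
      rw [add_assoc, pow_add, mul_assoc, mul_inv_cancel₀ (pow_ne_zero _ hq0), mul_one]
    rw [hinv, eq_inv_mul_iff_mul_eq₀ hq1]
    linear_combination hup' - hlow
  · rw [AttP.card_common_upper_covers hxy, AttP.card_common_lower_covers hxy]
    simp only [hxy, false_and, if_false, mul_zero, Finset.sum_const_zero,
      Matrix.one_apply_ne hxy, sub_zero, add_zero]
    by_cases hc : finrank F x.1 = finrank F y.1 ∧
        finrank F ↥(x.1 ⊔ y.1) = finrank F x.1 + 1
    · have hle := AttP.finrank_inf_le_one (le_sup_left : x.1 ≤ x.1 ⊔ y.1) hc.2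
      rcases Nat.le_one_iff_eq_zero_or_eq_one.mp hle with h0 | h0 <;> simp [hc.1, hc.2, h0]
    · rw [if_neg (fun hh => hc ⟨hh.1, hh.2.1⟩), if_neg (fun hh => hc ⟨hh.1, hh.2.1⟩), if_neg hc]
      simp
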